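/- Let 0 < q < 1 and let (E_j)_{j≥1} be independent events with P(E_j) = q^j/(1+q^j). For d ≥ 3, 1 ≤ r < d/2, let U_{d,r} be the event that for all n ≥ 0: if E_{nd+r} occurs then E_{nd+d-r} and E_{(n+1)d} do not; if E_{nd+d-r} occurs then E_{(n+1)d} and E_{(n+1)d+r} do not; and if E_{(n+1)d} occurs then E_{(n+1)d+r}, E_{(n+1)d+d-r}, E_{(n+2)d} do not. Let F_j = E_j^c. Then P(F_r ∩ F_{d-r} ∩ F_d | U_{d,r}) = g₃(-q^r; q^d). -/

import Mathlib

open scoped BigOperators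
open MeasureTheory ProbabilityTheory

/-- The real finite q-Pochhammer symbol `(a; q)_n`. -/
noncomputable def qPochR (a q : ℝ) (n : ℕ) : ℝ := ∏ j ∈ Finset.range n, (1 - a * q ^ j)

/-- Hickerson's universal mock theta function (real arguments). -/
noncomputable def g3R (x q : ℝ) : ℝ :=
  ∑' n : ℕ, q ^ (n * (n + 1)) / (qPochR x q (n + 1) * qPochR (x⁻¹ * q) q (n + 1))

open Filter Topology Finset

/-- The infinite product `∏_{j ≥ 0} (1 + y Q^j)`, i.e. `(-y; Q)_∞`. -/
noncomputable def qInf (y Q : ℝ) : ℝ := ∏' j : ℕ, (1 + y * Q ^ j)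

section Product

variable {y Q : ℝ}

lemma multipliable_one_add_mul_pow (hQ0 : 0 ≤ Q) (hQ1 : Q < 1) (y : ℝ) :
    Multipliable fun j : ℕ => 1 + y * Q ^ j :=
  Real.multipliable_one_add_of_summable ((summable_geometric_of_lt_one hQ0 hQ1).mul_left y)

lemma qInf_eq_mul (hQ0 : 0 ≤ Q) (hQ1 : Q < 1) (y : ℝ) :
    qInf y Q = (1 + y) * qInf (y * Q) Q := by
  have h : ∀ j : ℕ, 1 + y * Q ^ (j + 1) = 1 + y * Q * Q ^ j := fun j => by ring
  have hm : Multipliable fun j : ℕ => 1 + y * Q ^ (j + 1) := by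
    simpa only [h] using multipliable_one_add_mul_pow hQ0 hQ1 (y * Q)
  unfold qInf
  rw [tprod_eq_zero_mul' (f := fun j : ℕ => 1 + y * Q ^ j) hm]
  simp only [h, pow_zero, mul_one]

lemma qInf_eq_prod_mul (hQ0 : 0 ≤ Q) (hQ1 : Q < 1) (y : ℝ) (n : ℕ) :
    qInf y Q = (∏ j ∈ range n, (1 + y * Q ^ j)) * qInf (y * Q ^ n) Q := by
  induction n with
  | zero => simp
  | succ n ih => rw [ih, prod_range_succ, qInf_eq_mul hQ0 hQ1 (y * Q ^ n)]; ring_nf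

lemma one_le_qInf (hQ0 : 0 ≤ Q) (hQ1 : Q < 1) (hy : 0 ≤ y) : 1 ≤ qInf y Q := by
  refine ge_of_tendsto' (multipliable_one_add_mul_pow hQ0 hQ1 y).hasProd.tendsto_prod_nat
    fun n => ?_
  exact Finset.prod_induction _ (fun x : ℝ => 1 ≤ x)
    (fun a b ha hb => one_le_mul_of_one_le_of_one_le ha hb) le_rfl
    fun i _ => le_add_of_nonneg_right (by positivity)

lemma qInf_le_exp (hQ0 : 0 ≤ Q) (hQ1 : Q < 1) (hy : 0 ≤ y) :
    qInf y Q ≤ Real.exp (y / (1 - Q)) := by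
  refine le_of_tendsto' (multipliable_one_add_mul_pow hQ0 hQ1 y).hasProd.tendsto_prod_nat
    fun n => ?_
  refine (Real.prod_one_add_le_exp_sum _ fun i => by positivity).trans (Real.exp_le_exp.2 ?_)
  rw [← mul_sum, div_eq_mul_inv, ← tsum_geometric_of_lt_one hQ0 hQ1]
  gcongr
  exact (summable_geometric_of_lt_one hQ0 hQ1).sum_le_tsum _ fun i _ => by positivity

lemma qInf_mul_pow_le (hQ0 : 0 ≤ Q) (hQ1 : Q < 1) (hy : 0 ≤ y) (n : ℕ) :
    qInf (y * Q ^ n) Q ≤ Real.exp (y / (1 - Q)) := by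
  refine (qInf_le_exp hQ0 hQ1 (by positivity)).trans (Real.exp_le_exp.2 ?_)
  have : 0 < 1 - Q := by linarith
  gcongr
  exact mul_le_of_le_one_right hy (pow_le_one₀ hQ0 hQ1.le)

lemma tendsto_qInf_mul_pow (hQ0 : 0 ≤ Q) (hQ1 : Q < 1) (hy : 0 ≤ y) :
    Tendsto (fun n : ℕ => qInf (y * Q ^ n) Q) atTop (𝓝 1) := by
  have h : Tendsto (fun n : ℕ => Real.exp (y * Q ^ n / (1 - Q))) atTop (𝓝 1) := by
    have := (((tendsto_pow_atTop_nhds_zero_of_lt_one hQ0 hQ1).const_mul y).div_const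
      (1 - Q)).rexp
    simpa using this
  exact tendsto_of_tendsto_of_tendsto_of_le_of_le tendsto_const_nhds h
    (fun n => one_le_qInf hQ0 hQ1 (by positivity))
    fun n => qInf_le_exp hQ0 hQ1 (by positivity)

end Product

/-- A solution, tending to `0`, of a three-term recurrence whose coefficients are geometrically
close to `(1, 0)` vanishes. -/
lemma eq_zero_of_recurrence {Q K : ℝ} (hQ0 : 0 ≤ Q) (hQ1 : Q < 1) (hK : 0 ≤ K)
    {D e f : ℕ → ℝ} (he : ∀ k, 0 ≤ e k) (hf : ∀ k, 0 ≤ f k)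
    (hef : ∀ k, e k + f k ≤ K * Q ^ k)
    (hD : ∀ k, D k = (1 + e k) * D (k + 1) + f k * D (k + 2))
    (hlim : Tendsto D atTop (𝓝 0)) (k : ℕ) : D k = 0 := by
  set M : ℕ → ℝ := fun k => max |D k| |D (k + 1)| with hM
  have hM0 : ∀ k, 0 ≤ M k := fun k => le_max_of_le_left (abs_nonneg _)
  have hstep : ∀ k, M k ≤ (1 + K * Q ^ k) * M (k + 1) := by
    intro k
    have h1 : |D (k + 1)| ≤ M (k + 1) := le_max_left _ _
    have h2 : |D (k + 2)| ≤ M (k + 1) := le_max_right _ _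
    have hKQ : 0 ≤ K * Q ^ k := by positivity
    refine max_le ?_ ?_
    · rw [hD k]
      calc |(1 + e k) * D (k + 1) + f k * D (k + 2)|
          ≤ |(1 + e k) * D (k + 1)| + |f k * D (k + 2)| := abs_add_le _ _
        _ = (1 + e k) * |D (k + 1)| + f k * |D (k + 2)| := by
            rw [abs_mul, abs_mul, abs_of_nonneg (hf k),
              abs_of_nonneg (show 0 ≤ 1 + e k by linarith [he k])]
        _ ≤ (1 + e k) * M (k + 1) + f k * M (k + 1) := by
            have := he k; have := hf k; gcongr
        _ = (1 + (e k + f k)) * M (k + 1) := by ring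
        _ ≤ (1 + K * Q ^ k) * M (k + 1) := by
            have := hM0 (k + 1); have := hef k; gcongr
    · nlinarith [hM0 (k + 1)]
  have hI : ∀ k : ℕ, 1 ≤ qInf (K * Q ^ k) Q := fun k => one_le_qInf hQ0 hQ1 (by positivity)
  have hmono : Monotone fun k => M k / qInf (K * Q ^ k) Q := by
    refine monotone_nat_of_le_succ fun k => ?_
    have h1 := hI (k + 1)
    have hKQ : 0 ≤ K * Q ^ k := by positivity
    have hq := qInf_eq_mul hQ0 hQ1 (K * Q ^ k)
    rw [mul_assoc, ← pow_succ] at hq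
    rw [div_le_div_iff₀ (by linarith [hI k]) (by linarith), hq]
    nlinarith [hstep k]
  have hMlim : Tendsto M atTop (𝓝 0) := by
    have := hlim.abs.max ((tendsto_add_atTop_iff_nat 1).2 hlim).abs
    simpa using this
  have hquot : Tendsto (fun k => M k / qInf (K * Q ^ k) Q) atTop (𝓝 0) :=
    squeeze_zero (fun k => div_nonneg (hM0 k) (by linarith [hI k]))
      (fun k => div_le_self (hM0 k) (hI k)) hMlim
  have h := hmono.ge_of_tendsto hquot k
  have hpos : 0 < qInf (K * Q ^ k) Q := by linarith [hI k]
  have hMk : M k ≤ 0 := by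
    by_contra! hc
    exact absurd h (not_le.2 (div_pos hc hpos))
  exact abs_nonpos_iff.1 ((le_max_left _ _).trans hMk)

section Series

variable {Q : ℝ}

lemma qPochR_succ (a q : ℝ) (n : ℕ) : qPochR a q (n + 1) = qPochR a q n * (1 - a * q ^ n) :=
  prod_range_succ _ _

lemma qPochR_succ' (a q : ℝ) (n : ℕ) :
    qPochR a q (n + 1) = (1 - a) * qPochR (a * q) q n := by
  simp only [qPochR, prod_range_succ', pow_zero, mul_one]
  rw [mul_comm]
  congr 1
  exact prod_congr rfl fun j _ => by ring

lemma qPochR_mem_Icc (hQ0 : 0 ≤ Q) (hQ1 : Q < 1) (k n : ℕ) :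
    qPochR (Q ^ k) Q n ∈ Set.Icc (0 : ℝ) 1 := by
  have h : ∀ j, Q ^ k * Q ^ j ≤ 1 := fun j => by
    rw [← pow_add]; exact pow_le_one₀ hQ0 hQ1.le
  refine ⟨prod_nonneg fun j _ => by linarith [h j], prod_le_one (fun j _ => by linarith [h j])
    fun j _ => ?_⟩
  have : 0 ≤ Q ^ k * Q ^ j := by positivity
  linarith

lemma qPochR_self_pos (hQ0 : 0 ≤ Q) (hQ1 : Q < 1) (n : ℕ) : 0 < qPochR Q Q n :=
  prod_pos fun j _ => by
    rw [← pow_succ']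
    linarith [pow_lt_one₀ hQ0 hQ1 (Nat.add_one_ne_zero j)]

lemma inv_qPochR_self_le (hQ0 : 0 ≤ Q) (hQ1 : Q < 1) (n : ℕ) :
    (qPochR Q Q n)⁻¹ ≤ qInf (Q / (1 - Q)) Q := by
  have h1Q : 0 < 1 - Q := by linarith
  have hy : 0 ≤ Q / (1 - Q) := by positivity
  have hle : (qPochR Q Q n)⁻¹ ≤ ∏ j ∈ range n, (1 + Q / (1 - Q) * Q ^ j) := by
    rw [qPochR, ← prod_inv_distrib]
    refine prod_le_prod (fun j _ => ?_) fun j _ => ?_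
    all_goals
      have hj : Q ^ j ≤ 1 := pow_le_one₀ hQ0 hQ1.le
      have hj0 : 0 ≤ Q ^ j := by positivity
      have hlt : 0 < 1 - Q * Q ^ j := by nlinarith
    · positivity
    · rw [inv_le_iff_one_le_mul₀ hlt, ← sub_nonneg]
      have : (1 + Q / (1 - Q) * Q ^ j) * (1 - Q * Q ^ j) - 1
          = Q ^ 2 * Q ^ j * (1 - Q ^ j) / (1 - Q) := by field_simp; ring
      rw [this]
      have : 0 ≤ 1 - Q ^ j := by linarith
      positivity
  refine hle.trans ?_
  rw [qInf_eq_prod_mul hQ0 hQ1 _ n]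
  refine le_mul_of_one_le_right (prod_nonneg fun j _ => by positivity) ?_
  exact one_le_qInf hQ0 hQ1 (by positivity)

/-- The summand `(Q^k; Q)_n / (Q; Q)_n * Q^(n^2 + k n) * P (k + n)`. -/
noncomputable def gapTerm (Q : ℝ) (P : ℕ → ℝ) (k n : ℕ) : ℝ :=
  qPochR (Q ^ k) Q n / qPochR Q Q n * Q ^ (n ^ 2 + k * n) * P (k + n)

variable {P : ℕ → ℝ} {C : ℝ}

lemma gapTerm_nonneg (hQ0 : 0 ≤ Q) (hQ1 : Q < 1) (hP0 : ∀ m, 0 ≤ P m) (k n : ℕ) :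
    0 ≤ gapTerm Q P k n :=
  mul_nonneg (mul_nonneg (div_nonneg (qPochR_mem_Icc hQ0 hQ1 k n).1 (qPochR_self_pos hQ0 hQ1 n).le)
    (by positivity)) (hP0 _)

lemma gapTerm_le_mul_pow (hQ0 : 0 ≤ Q) (hQ1 : Q < 1) (hP0 : ∀ m, 0 ≤ P m) (hPC : ∀ m, P m ≤ C)
    (k n : ℕ) : gapTerm Q P k n ≤ qInf (Q / (1 - Q)) Q * C * Q ^ (n ^ 2 + k * n) := by
  have h := qPochR_mem_Icc hQ0 hQ1 k n
  have hi := inv_qPochR_self_le hQ0 hQ1 n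
  have hi0 : 0 ≤ (qPochR Q Q n)⁻¹ := (inv_pos.2 (qPochR_self_pos hQ0 hQ1 n)).le
  have h1 : qPochR (Q ^ k) Q n / qPochR Q Q n ≤ qInf (Q / (1 - Q)) Q := by
    rw [div_eq_mul_inv]
    exact (mul_le_of_le_one_left hi0 h.2).trans hi
  have hI : 0 ≤ qInf (Q / (1 - Q)) Q := hi0.trans hi
  rw [gapTerm, mul_right_comm _ C]
  exact mul_le_mul (mul_le_mul_of_nonneg_right h1 (by positivity)) (hPC _) (hP0 _) (by positivity)

lemma gapTerm_le (hQ0 : 0 ≤ Q) (hQ1 : Q < 1) (hP0 : ∀ m, 0 ≤ P m) (hPC : ∀ m, P m ≤ C)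
    (k n : ℕ) : gapTerm Q P k n ≤ qInf (Q / (1 - Q)) Q * C * Q ^ n := by
  have hI : 0 ≤ qInf (Q / (1 - Q)) Q :=
    (inv_pos.2 (qPochR_self_pos hQ0 hQ1 0)).le.trans (inv_qPochR_self_le hQ0 hQ1 0)
  have hC : 0 ≤ C := (hP0 0).trans (hPC 0)
  refine (gapTerm_le_mul_pow hQ0 hQ1 hP0 hPC k n).trans
    (mul_le_mul_of_nonneg_left (pow_le_pow_of_le_one hQ0 hQ1.le ?_) (by positivity))
  nlinarith [Nat.zero_le (k * n), Nat.le_self_pow two_ne_zero n]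

lemma summable_gapTerm (hQ0 : 0 ≤ Q) (hQ1 : Q < 1) (hP0 : ∀ m, 0 ≤ P m) (hPC : ∀ m, P m ≤ C)
    (k : ℕ) : Summable (gapTerm Q P k) :=
  .of_nonneg_of_le (gapTerm_nonneg hQ0 hQ1 hP0 k) (gapTerm_le hQ0 hQ1 hP0 hPC k)
    ((summable_geometric_of_lt_one hQ0 hQ1).mul_left _)

lemma gapTerm_zero (k : ℕ) : gapTerm Q P k 0 = P k := by simp [gapTerm, qPochR]

lemma tendsto_tsum_gapTerm (hQ0 : 0 ≤ Q) (hQ1 : Q < 1) (hP0 : ∀ m, 0 ≤ P m)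
    (hPC : ∀ m, P m ≤ C) (hP : Tendsto P atTop (𝓝 1)) :
    Tendsto (fun k => ∑' n, gapTerm Q P k n) atTop (𝓝 1) := by
  have h := tendsto_tsum_of_dominated_convergence (𝓕 := atTop) (f := gapTerm Q P)
    (g := fun n => if n = 0 then (1 : ℝ) else 0)
    ((summable_geometric_of_lt_one hQ0 hQ1).mul_left (qInf (Q / (1 - Q)) Q * C)) ?_ ?_
  · simpa using h
  · intro n
    rcases Nat.eq_zero_or_pos n with rfl | hn
    · simpa [gapTerm_zero] using hP
    · rw [if_neg hn.ne']
      refine squeeze_zero (fun k => gapTerm_nonneg hQ0 hQ1 hP0 k n)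
        (g := fun k => qInf (Q / (1 - Q)) Q * C * Q ^ k) (fun k => ?_) ?_
      · have hI : 0 ≤ qInf (Q / (1 - Q)) Q :=
          (inv_pos.2 (qPochR_self_pos hQ0 hQ1 0)).le.trans (inv_qPochR_self_le hQ0 hQ1 0)
        have hC : 0 ≤ C := (hP0 0).trans (hPC 0)
        refine (gapTerm_le_mul_pow hQ0 hQ1 hP0 hPC k n).trans
          (mul_le_mul_of_nonneg_left (pow_le_pow_of_le_one hQ0 hQ1.le ?_) (by positivity))
        nlinarith [Nat.le_mul_of_pos_right k hn]
      · simpa using (tendsto_pow_atTop_nhds_zero_of_lt_one hQ0 hQ1).const_mul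
          (qInf (Q / (1 - Q)) Q * C)
  · refine Eventually.of_forall fun k n => ?_
    rw [Real.norm_of_nonneg (gapTerm_nonneg hQ0 hQ1 hP0 k n)]
    exact gapTerm_le hQ0 hQ1 hP0 hPC k n

lemma sum_gapTerm_telescope (hQ0 : 0 ≤ Q) (hQ1 : Q < 1) {s : ℝ}
    (hPrec : ∀ m, P m = (1 + s * Q ^ m + Q ^ (2 * m + 1)) * P (m + 1)) (k n : ℕ) :
    ∑ i ∈ range (n + 1), gapTerm Q P k i
      - (1 + s * Q ^ k) * ∑ i ∈ range (n + 1), gapTerm Q P (k + 1) i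
      - Q ^ (k + 1) * (1 - Q ^ (k + 1)) * ∑ i ∈ range n, gapTerm Q P (k + 2) i
      = Q ^ (2 * k + n + 1) * gapTerm Q P (k + 1) n := by
  induction n with
  | zero =>
    simp only [zero_add, sum_range_one, range_zero, sum_empty, gapTerm_zero, hPrec k]
    ring
  | succ n ih =>
    rw [sum_range_succ _ (n + 1), sum_range_succ _ (n + 1),
      sum_range_succ (gapTerm Q P (k + 2)) n]
    have hstep : gapTerm Q P k (n + 1) - (1 + s * Q ^ k) * gapTerm Q P (k + 1) (n + 1)
        - Q ^ (k + 1) * (1 - Q ^ (k + 1)) * gapTerm Q P (k + 2) n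
        = Q ^ (2 * k + (n + 1) + 1) * gapTerm Q P (k + 1) (n + 1)
          - Q ^ (2 * k + n + 1) * gapTerm Q P (k + 1) n := by
      have hpos := (qPochR_self_pos hQ0 hQ1 n).ne'
      have hpos' : 1 - Q * Q ^ n ≠ 0 := by
        rw [← pow_succ']
        exact (sub_pos.2 (pow_lt_one₀ hQ0 hQ1 (Nat.add_one_ne_zero n))).ne'
      have e1 : qPochR (Q ^ k) Q (n + 1) = (1 - Q ^ k) * qPochR (Q ^ (k + 1)) Q n := by
        rw [qPochR_succ', pow_succ]
      have e2 : (1 - Q ^ (k + 1)) * qPochR (Q ^ (k + 2)) Q n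
          = qPochR (Q ^ (k + 1)) Q n * (1 - Q ^ (k + 1) * Q ^ n) := by
        rw [← qPochR_succ, qPochR_succ', ← pow_succ]
      have e3 : Q ^ (k + 1) * (1 - Q ^ (k + 1)) * gapTerm Q P (k + 2) n
          = Q ^ (k + 1) * (qPochR (Q ^ (k + 1)) Q n * (1 - Q ^ (k + 1) * Q ^ n) / qPochR Q Q n
            * Q ^ (n ^ 2 + (k + 2) * n) * P (k + n + 2)) := by
        rw [gapTerm, ← e2, show k + 2 + n = k + n + 2 by ring]; ring
      have hp := hPrec (k + n + 1)
      rw [e3]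
      simp only [gapTerm]
      rw [e1, qPochR_succ (Q ^ (k + 1)), qPochR_succ Q,
        show k + (n + 1) = k + n + 1 by ring, show k + 1 + (n + 1) = k + n + 2 by ring,
        show k + 1 + n = k + n + 1 by ring, hp]
      field_simp
      ring
    linear_combination ih + hstep

lemma tsum_gapTerm_recurrence (hQ0 : 0 ≤ Q) (hQ1 : Q < 1) (hP0 : ∀ m, 0 ≤ P m)
    (hPC : ∀ m, P m ≤ C) {s : ℝ}
    (hPrec : ∀ m, P m = (1 + s * Q ^ m + Q ^ (2 * m + 1)) * P (m + 1)) (k : ℕ) :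
    ∑' n, gapTerm Q P k n = (1 + s * Q ^ k) * ∑' n, gapTerm Q P (k + 1) n
      + Q ^ (k + 1) * (1 - Q ^ (k + 1)) * ∑' n, gapTerm Q P (k + 2) n := by
  have hs := fun k => summable_gapTerm hQ0 hQ1 hP0 hPC k
  have ht := fun k => (hs k).hasSum.tendsto_sum_nat
  have hl := ((((tendsto_add_atTop_iff_nat 1).2 (ht k)).sub
    (((tendsto_add_atTop_iff_nat 1).2 (ht (k + 1))).const_mul (1 + s * Q ^ k))).sub
    ((ht (k + 2)).const_mul (Q ^ (k + 1) * (1 - Q ^ (k + 1)))))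
  simp only [sum_gapTerm_telescope hQ0 hQ1 hPrec] at hl
  have h0 : Tendsto (fun n => Q ^ (2 * k + n + 1) * gapTerm Q P (k + 1) n) atTop (𝓝 0) :=
    squeeze_zero (fun n => mul_nonneg (by positivity) (gapTerm_nonneg hQ0 hQ1 hP0 _ _))
      (fun n => mul_le_of_le_one_left (gapTerm_nonneg hQ0 hQ1 hP0 _ _)
        (pow_le_one₀ hQ0 hQ1.le)) (hs (k + 1)).tendsto_atTop_zero
  linarith [tendsto_nhds_unique hl h0]

lemma tsum_gapTerm_zero : ∑' n, gapTerm Q P 0 n = P 0 := by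
  rw [tsum_eq_single 0, gapTerm_zero]
  intro n hn
  obtain ⟨m, rfl⟩ := Nat.exists_eq_succ_of_ne_zero hn
  simp [gapTerm, Nat.succ_eq_add_one, qPochR_succ']

end Series

/-- The tail product `(-y₁ Q^m; Q)_∞ (-y₂ Q^m; Q)_∞`. -/
noncomputable def qTail (y₁ y₂ Q : ℝ) (m : ℕ) : ℝ := qInf (y₁ * Q ^ m) Q * qInf (y₂ * Q ^ m) Q

section Tail

variable {y₁ y₂ Q : ℝ}

lemma qTail_succ (hQ0 : 0 ≤ Q) (hQ1 : Q < 1) (hy : y₁ * y₂ = Q) (m : ℕ) :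
    qTail y₁ y₂ Q m = (1 + (y₁ + y₂) * Q ^ m + Q ^ (2 * m + 1)) * qTail y₁ y₂ Q (m + 1) := by
  have h : Q ^ (2 * m + 1) = y₁ * y₂ * (Q ^ m * Q ^ m) := by rw [hy]; ring
  rw [qTail, qInf_eq_mul hQ0 hQ1 (y₁ * Q ^ m), qInf_eq_mul hQ0 hQ1 (y₂ * Q ^ m), qTail, h,
    mul_assoc y₁, mul_assoc y₂, ← pow_succ]
  ring

lemma qTail_pos (hQ0 : 0 ≤ Q) (hQ1 : Q < 1) (h₁ : 0 ≤ y₁) (h₂ : 0 ≤ y₂) (m : ℕ) :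
    0 < qTail y₁ y₂ Q m :=
  mul_pos (zero_lt_one.trans_le (one_le_qInf hQ0 hQ1 (by positivity)))
    (zero_lt_one.trans_le (one_le_qInf hQ0 hQ1 (by positivity)))

lemma qTail_le (hQ0 : 0 ≤ Q) (hQ1 : Q < 1) (h₁ : 0 ≤ y₁) (h₂ : 0 ≤ y₂) (m : ℕ) :
    qTail y₁ y₂ Q m ≤ Real.exp (y₁ / (1 - Q)) * Real.exp (y₂ / (1 - Q)) :=
  mul_le_mul (qInf_mul_pow_le hQ0 hQ1 h₁ m) (qInf_mul_pow_le hQ0 hQ1 h₂ m)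
    (zero_le_one.trans (one_le_qInf hQ0 hQ1 (by positivity))) (Real.exp_nonneg _)

lemma tendsto_qTail (hQ0 : 0 ≤ Q) (hQ1 : Q < 1) (h₁ : 0 ≤ y₁) (h₂ : 0 ≤ y₂) :
    Tendsto (qTail y₁ y₂ Q) atTop (𝓝 1) := by
  have h := (tendsto_qInf_mul_pow hQ0 hQ1 h₁).mul (tendsto_qInf_mul_pow hQ0 hQ1 h₂)
  rwa [one_mul] at h

lemma tsum_gapTerm_one (hQ0 : 0 < Q) (hQ1 : Q < 1) (h₁ : 0 < y₁) (h₂ : 0 < y₂)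
    (hy : y₁ * y₂ = Q) :
    ∑' n, gapTerm Q (qTail y₁ y₂ Q) 1 n = qTail y₁ y₂ Q 0 * g3R (-y₁) Q := by
  rw [g3R, ← tsum_mul_left]
  refine tsum_congr fun n => ?_
  have hinv : (-y₁)⁻¹ * Q = -y₂ := by rw [← hy]; field_simp
  have hp : ∀ y : ℝ, 0 < y → 0 < qPochR (-y) Q (n + 1) := fun y hy0 =>
    prod_pos fun j _ => by rw [neg_mul, sub_neg_eq_add]; positivity
  have hI : ∀ y : ℝ, qInf (y * Q ^ 0) Q = qPochR (-y) Q (n + 1) * qInf (y * Q ^ (1 + n)) Q := by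
    intro y
    rw [pow_zero, mul_one, qInf_eq_prod_mul hQ0.le hQ1 y (n + 1), add_comm 1 n]
    simp [qPochR]
  have hq := (qPochR_self_pos hQ0.le hQ1 n).ne'
  have hp₁ := (hp y₁ h₁).ne'
  have hp₂ := (hp y₂ h₂).ne'
  rw [gapTerm, qTail, qTail, hI y₁, hI y₂, hinv, pow_one, div_self hq]
  field_simp
  ring_nf

/-- Any solution tending to `1` of the Schur-type recurrence satisfies
`S 1 = S 0 * g₃(-y₁; Q)`, with `S 0` the tail product. -/
lemma recurrence_solution (hQ0 : 0 < Q) (hQ1 : Q < 1) (h₁ : 0 < y₁) (h₂ : 0 < y₂)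
    (hy : y₁ * y₂ = Q) {S : ℕ → ℝ} (hlim : Tendsto S atTop (𝓝 1))
    (hS : ∀ k, S k = (1 + (y₁ + y₂) * Q ^ k) * S (k + 1)
      + Q ^ (k + 1) * (1 - Q ^ (k + 1)) * S (k + 2)) :
    0 < S 0 ∧ S 1 = S 0 * g3R (-y₁) Q := by
  set F : ℕ → ℝ := fun k => ∑' n, gapTerm Q (qTail y₁ y₂ Q) k n
  have hP0 := fun m => (qTail_pos hQ0.le hQ1 h₁.le h₂.le m).le
  have hPC := fun m => qTail_le hQ0.le hQ1 h₁.le h₂.le m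
  have hF := tsum_gapTerm_recurrence hQ0.le hQ1 hP0 hPC (qTail_succ hQ0.le hQ1 hy)
  have hFlim := tendsto_tsum_gapTerm hQ0.le hQ1 hP0 hPC (tendsto_qTail hQ0.le hQ1 h₁.le h₂.le)
  have hSF : ∀ k, S k = F k := by
    intro k
    have hpow : ∀ k : ℕ, Q ^ (k + 1) ≤ 1 := fun k => pow_le_one₀ hQ0.le hQ1.le
    refine sub_eq_zero.1 (eq_zero_of_recurrence (D := fun k => S k - F k)
      (e := fun k => (y₁ + y₂) * Q ^ k) (f := fun k => Q ^ (k + 1) * (1 - Q ^ (k + 1)))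
      (K := y₁ + y₂ + Q) hQ0.le hQ1 (by positivity) (fun k => by positivity)
      (fun k => mul_nonneg (by positivity) (by linarith [hpow k])) (fun k => ?_) (fun k => ?_)
      (by simpa using hlim.sub hFlim) k)
    · have : 0 < Q ^ (k + 1) * Q ^ (k + 1) := by positivity
      linarith [pow_succ Q k]
    · simp only [F]
      linear_combination hS k - hF k
  rw [hSF 0, hSF 1]
  simp only [F, tsum_gapTerm_zero]
  exact ⟨qTail_pos hQ0.le hQ1 h₁.le h₂.le 0, tsum_gapTerm_one hQ0 hQ1 h₁ h₂ hy⟩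

end Tail

section Events

variable {Ω : Type*}

/-- The σ-algebra generated by the events `E i` with `i > j`. -/
abbrev tailEvents (E : ℕ → Set Ω) (j : ℕ) : MeasurableSpace Ω :=
  MeasurableSpace.generateFrom {t | ∃ i ∈ Set.Ioi j, E i = t}

/-- The event that the constraints at all levels `n ≥ k` hold. -/
def gapEvent (E : ℕ → Set Ω) (d r k : ℕ) : Set Ω :=
  ⋂ n ≥ k,
    (E (n * d + r) ∩ (E (n * d + (d - r)) ∪ E ((n + 1) * d)))ᶜ ∩
    (E (n * d + (d - r)) ∩ (E ((n + 1) * d) ∪ E ((n + 1) * d + r)))ᶜ ∩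
    (E ((n + 1) * d) ∩
      (E ((n + 1) * d + r) ∪ E ((n + 1) * d + (d - r)) ∪ E ((n + 2) * d)))ᶜ

variable {E : ℕ → Set Ω} {d r : ℕ}

lemma tailEvents_anti {i j : ℕ} (h : i ≤ j) : tailEvents E j ≤ tailEvents E i :=
  MeasurableSpace.generateFrom_mono fun _ ⟨n, hn, hE⟩ => ⟨n, h.trans_lt hn, hE⟩

lemma measurableSet_tailEvents {i j : ℕ} (h : j < i) : MeasurableSet[tailEvents E j] (E i) :=
  MeasurableSpace.measurableSet_generateFrom ⟨i, h, rfl⟩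

lemma tailEvents_le [m : MeasurableSpace Ω] (hmeas : ∀ j, MeasurableSet (E j)) (j : ℕ) :
    tailEvents E j ≤ m :=
  MeasurableSpace.generateFrom_le fun _ ⟨n, _, hE⟩ => hE ▸ hmeas n

lemma measurableSet_gapEvent {j k : ℕ} (hr : 1 ≤ r) (hrd : r < d) (hj : j ≤ k * d) :
    MeasurableSet[tailEvents E j] (gapEvent E d r k) := by
  refine MeasurableSet.iInter fun n => MeasurableSet.iInter fun hn => ?_
  have hnd : k * d ≤ n * d := Nat.mul_le_mul_right d hn
  have h1 : (n + 1) * d = n * d + d := by ring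
  have h2 : (n + 2) * d = n * d + 2 * d := by ring
  have hE : ∀ i, j < i → MeasurableSet[tailEvents E j] (E i) :=
    fun i => measurableSet_tailEvents
  have a := hE (n * d + r) (by omega)
  have b := hE (n * d + (d - r)) (by omega)
  have c := hE ((n + 1) * d) (by omega)
  have a' := hE ((n + 1) * d + r) (by omega)
  have b' := hE ((n + 1) * d + (d - r)) (by omega)
  have c' := hE ((n + 2) * d) (by omega)
  exact ((a.inter (b.union c)).compl.inter (b.inter (c.union a')).compl).inter
    (c.inter ((a'.union b').union c')).compl

lemma gapEvent_eq_inter (k : ℕ) : gapEvent E d r k =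
    ((E (k * d + r) ∩ (E (k * d + (d - r)) ∪ E ((k + 1) * d)))ᶜ ∩
    (E (k * d + (d - r)) ∩ (E ((k + 1) * d) ∪ E ((k + 1) * d + r)))ᶜ ∩
    (E ((k + 1) * d) ∩
      (E ((k + 1) * d + r) ∪ E ((k + 1) * d + (d - r)) ∪ E ((k + 2) * d)))ᶜ) ∩
    gapEvent E d r (k + 1) := by
  ext ω
  rw [Set.mem_inter_iff]
  unfold gapEvent
  rw [Set.mem_iInter₂, Set.mem_iInter₂]
  refine ⟨fun h => ⟨h k le_rfl, fun n hn => h n (by omega)⟩, fun h n hn => ?_⟩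
  rcases hn.eq_or_lt with rfl | hn
  · exact h.1
  · exact h.2 n hn

lemma gapEvent_mono : Monotone (gapEvent E d r) :=
  fun _ _ h => Set.biInter_subset_biInter_left fun _ hn => h.trans hn

variable [MeasurableSpace Ω] {μ : Measure Ω}

lemma measureReal_inter_tail (hmeas : ∀ j, MeasurableSet (E j)) (hindep : iIndepSet E μ)
    {j : ℕ} {X : Set Ω} (hX : MeasurableSet[tailEvents E j] X) :
    μ.real (E j ∩ X) = μ.real (E j) * μ.real X := by
  have h := (Indep_iff _ _ _).1 (hindep.indep_generateFrom_of_disjoint hmeas {j} (Set.Ioi j)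
    (by simp)) (E j) X (MeasurableSpace.measurableSet_generateFrom ⟨j, rfl, rfl⟩) hX
  simp [Measure.real, h, ENNReal.toReal_mul]

variable [IsProbabilityMeasure μ]

lemma measureReal_inter_add_compl_inter {A : Set Ω} (hA : MeasurableSet A) (X : Set Ω) :
    μ.real (A ∩ X) + μ.real (Aᶜ ∩ X) = μ.real X := by
  rw [Set.inter_comm A, Set.inter_comm Aᶜ, ← Set.sdiff_eq]
  exact measureReal_inter_add_sdiff hA

lemma measureReal_compl_inter_tail (hmeas : ∀ j, MeasurableSet (E j)) (hindep : iIndepSet E μ)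
    {j : ℕ} {X : Set Ω} (hX : MeasurableSet[tailEvents E j] X) :
    μ.real ((E j)ᶜ ∩ X) = (1 - μ.real (E j)) * μ.real X := by
  linarith [measureReal_inter_add_compl_inter (μ := μ) (hmeas j) X,
    measureReal_inter_tail hmeas hindep hX]

/-- Independence of a block of three successive complements from later events. -/
lemma measureReal_compl_block_inter (hmeas : ∀ j, MeasurableSet (E j))
    (hindep : iIndepSet E μ) {i j k : ℕ} (hij : i < j) (hjk : j < k) {X : Set Ω}
    (hX : MeasurableSet[tailEvents E k] X) :
    μ.real ((E i)ᶜ ∩ ((E j)ᶜ ∩ ((E k)ᶜ ∩ X))) =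
      (1 - μ.real (E i)) * (1 - μ.real (E j)) * (1 - μ.real (E k)) * μ.real X := by
  have hk := (measurableSet_tailEvents (E := E) hjk).compl.inter (tailEvents_anti hjk.le _ hX)
  have hj := (measurableSet_tailEvents (E := E) hij).compl.inter (tailEvents_anti hij.le _ hk)
  rw [measureReal_compl_inter_tail hmeas hindep hj, measureReal_compl_inter_tail hmeas hindep hk,
    measureReal_compl_inter_tail hmeas hindep hX]
  ring

/-- Splitting the gap event according to the first occurring event of the first level. -/
lemma measureReal_gapEvent (hmeas : ∀ j, MeasurableSet (E j)) (hindep : iIndepSet E μ)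
    (hr : 1 ≤ r) (hrd : 2 * r < d) (k : ℕ) {p : ℕ → ℝ} (hp : ∀ j, μ.real (E j) = p j) :
    μ.real (gapEvent E d r k) =
      p (k * d + r) * (1 - p (k * d + (d - r))) * (1 - p ((k + 1) * d))
          * μ.real (gapEvent E d r (k + 1))
      + (1 - p (k * d + r)) * p (k * d + (d - r)) * (1 - p ((k + 1) * d))
          * (μ.real (gapEvent E d r (k + 1)) -
            p ((k + 1) * d + r) * (1 - p ((k + 1) * d + (d - r))) * (1 - p ((k + 2) * d))
              * μ.real (gapEvent E d r (k + 2)))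
      + (1 - p (k * d + r)) * (1 - p (k * d + (d - r))) * p ((k + 1) * d)
          * ((1 - p ((k + 1) * d + r)) * (1 - p ((k + 1) * d + (d - r)))
            * (1 - p ((k + 2) * d)) * μ.real (gapEvent E d r (k + 2)))
      + (1 - p (k * d + r)) * (1 - p (k * d + (d - r))) * (1 - p ((k + 1) * d))
          * μ.real (gapEvent E d r (k + 1)) := by
  have h1 : (k + 1) * d = k * d + d := by ring
  have h2 : (k + 2) * d = k * d + 2 * d := by ring
  have hgap : ∀ {i k}, i ≤ k * d → MeasurableSet[tailEvents E i] (gapEvent E d r k) :=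
    measurableSet_gapEvent hr (by omega)
  have hev : ∀ {i j}, j < i → MeasurableSet[tailEvents E j] (E i) :=
    measurableSet_tailEvents
  have hin : ∀ {j X}, MeasurableSet[tailEvents E j] X →
      μ.real (E j ∩ X) = p j * μ.real X := fun hX => by
    rw [measureReal_inter_tail hmeas hindep hX, hp]
  have hco : ∀ {j X}, MeasurableSet[tailEvents E j] X →
      μ.real ((E j)ᶜ ∩ X) = (1 - p j) * μ.real X := fun hX => by
    rw [measureReal_compl_inter_tail hmeas hindep hX, hp]
  have hfirst : ∀ k, μ.real (E (k * d + r) ∩ gapEvent E d r k) =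
      p (k * d + r) * (1 - p (k * d + (d - r))) * (1 - p ((k + 1) * d))
        * μ.real (gapEvent E d r (k + 1)) := by
    intro k
    have h1 : (k + 1) * d = k * d + d := by ring
    have : E (k * d + r) ∩ gapEvent E d r k = E (k * d + r) ∩ ((E (k * d + (d - r)))ᶜ ∩
        ((E ((k + 1) * d))ᶜ ∩ gapEvent E d r (k + 1))) := by
      rw [gapEvent_eq_inter k]
      ext ω
      simp only [Set.mem_inter_iff, Set.mem_compl_iff, Set.mem_union]
      tauto
    rw [this, hin, hco, hco (hgap le_rfl)]
    · ring
    · exact (hev (by omega)).compl.inter (hgap (by omega))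
    · exact (hev (by omega)).compl.inter ((hev (by omega)).compl.inter (hgap (by omega)))
  have hsecond : μ.real (E (k * d + (d - r)) ∩ ((E (k * d + r))ᶜ ∩ gapEvent E d r k)) =
      (1 - p (k * d + r)) * p (k * d + (d - r)) * (1 - p ((k + 1) * d))
        * μ.real ((E ((k + 1) * d + r))ᶜ ∩ gapEvent E d r (k + 1)) := by
    have : E (k * d + (d - r)) ∩ ((E (k * d + r))ᶜ ∩ gapEvent E d r k) =
        (E (k * d + r))ᶜ ∩ (E (k * d + (d - r)) ∩ ((E ((k + 1) * d))ᶜ ∩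
          ((E ((k + 1) * d + r))ᶜ ∩ gapEvent E d r (k + 1)))) := by
      rw [gapEvent_eq_inter k]
      ext ω
      simp only [Set.mem_inter_iff, Set.mem_compl_iff, Set.mem_union]
      tauto
    have hX : ∀ {i}, i ≤ (k + 1) * d →
        MeasurableSet[tailEvents E i] ((E ((k + 1) * d + r))ᶜ ∩ gapEvent E d r (k + 1)) :=
      fun hi => (hev (by omega)).compl.inter (hgap (by omega))
    rw [this, hco, hin, hco (hX le_rfl)]
    · ring
    · exact (hev (by omega)).compl.inter (hX (by omega))
    · exact (hev (by omega)).inter ((hev (by omega)).compl.inter (hX (by omega)))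
  have hthird : μ.real (E ((k + 1) * d) ∩ ((E (k * d + (d - r)))ᶜ ∩
        ((E (k * d + r))ᶜ ∩ gapEvent E d r k))) =
      (1 - p (k * d + r)) * (1 - p (k * d + (d - r))) * p ((k + 1) * d)
        * ((1 - p ((k + 1) * d + r)) * (1 - p ((k + 1) * d + (d - r)))
          * (1 - p ((k + 2) * d)) * μ.real (gapEvent E d r (k + 2))) := by
    have : E ((k + 1) * d) ∩ ((E (k * d + (d - r)))ᶜ ∩ ((E (k * d + r))ᶜ ∩ gapEvent E d r k)) =
        (E (k * d + r))ᶜ ∩ ((E (k * d + (d - r)))ᶜ ∩ (E ((k + 1) * d) ∩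
          ((E ((k + 1) * d + r))ᶜ ∩ ((E ((k + 1) * d + (d - r)))ᶜ ∩ ((E ((k + 2) * d))ᶜ ∩
            gapEvent E d r (k + 2)))))) := by
      rw [gapEvent_eq_inter k, gapEvent_eq_inter (k + 1)]
      ext ω
      simp only [Set.mem_inter_iff, Set.mem_compl_iff, Set.mem_union, add_assoc,
        Nat.reduceAdd]
      tauto
    have hX : ∀ {i}, i ≤ (k + 1) * d → MeasurableSet[tailEvents E i]
        ((E ((k + 1) * d + r))ᶜ ∩ ((E ((k + 1) * d + (d - r)))ᶜ ∩ ((E ((k + 2) * d))ᶜ ∩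
            gapEvent E d r (k + 2)))) := fun hi =>
      (hev (by omega)).compl.inter ((hev (by omega)).compl.inter
        ((hev (by omega)).compl.inter (hgap (by omega))))
    rw [this, hco, hco, hin (hX le_rfl), measureReal_compl_block_inter hmeas hindep (by omega)
      (by omega) (hgap le_rfl), hp, hp, hp]
    · ring
    · exact (hev (by omega)).inter (hX (by omega))
    · exact (hev (by omega)).compl.inter ((hev (by omega)).inter (hX (by omega)))
  have hnone : μ.real ((E ((k + 1) * d))ᶜ ∩ ((E (k * d + (d - r)))ᶜ ∩
        ((E (k * d + r))ᶜ ∩ gapEvent E d r k))) =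
      (1 - p (k * d + r)) * (1 - p (k * d + (d - r))) * (1 - p ((k + 1) * d))
        * μ.real (gapEvent E d r (k + 1)) := by
    have : (E ((k + 1) * d))ᶜ ∩ ((E (k * d + (d - r)))ᶜ ∩
        ((E (k * d + r))ᶜ ∩ gapEvent E d r k)) =
        (E (k * d + r))ᶜ ∩ ((E (k * d + (d - r)))ᶜ ∩ ((E ((k + 1) * d))ᶜ ∩
          gapEvent E d r (k + 1))) := by
      rw [gapEvent_eq_inter k]
      ext ω
      simp only [Set.mem_inter_iff, Set.mem_compl_iff, Set.mem_union]
      tauto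
    rw [this, measureReal_compl_block_inter hmeas hindep (by omega) (by omega) (hgap le_rfl),
      hp, hp, hp]
  have s1 := fun k => measureReal_inter_add_compl_inter (μ := μ) (hmeas (k * d + r))
    (gapEvent E d r k)
  have s2 := measureReal_inter_add_compl_inter (μ := μ) (hmeas (k * d + (d - r)))
    ((E (k * d + r))ᶜ ∩ gapEvent E d r k)
  have s3 := measureReal_inter_add_compl_inter (μ := μ) (hmeas ((k + 1) * d))
    ((E (k * d + (d - r)))ᶜ ∩ ((E (k * d + r))ᶜ ∩ gapEvent E d r k))
  have hcompl : μ.real ((E ((k + 1) * d + r))ᶜ ∩ gapEvent E d r (k + 1)) =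
      μ.real (gapEvent E d r (k + 1)) -
        p ((k + 1) * d + r) * (1 - p ((k + 1) * d + (d - r))) * (1 - p ((k + 2) * d))
          * μ.real (gapEvent E d r (k + 2)) := by
    rw [eq_sub_iff_add_eq', ← hfirst (k + 1)]
    exact s1 (k + 1)
  rw [← s1 k, hfirst k, ← s2, hsecond, ← s3, hthird, hnone, hcompl]
  ring

lemma tendsto_measureReal_gapEvent (hr : 1 ≤ r) (hrd : r < d)
    (hsum : ∑' j, μ (E (j + 1)) ≠ ⊤) :
    Tendsto (fun k => μ.real (gapEvent E d r k)) atTop (𝓝 1) := by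
  have hone : μ (⋃ k, gapEvent E d r k) = 1 := by
    rw [← measure_univ (μ := μ)]
    refine measure_congr ?_
    filter_upwards [ae_eventually_notMem hsum] with ω hω
    obtain ⟨N, hN⟩ := eventually_atTop.1 hω
    refine propext ⟨fun _ => trivial, fun _ => Set.mem_iUnion.2 ⟨N + 1, ?_⟩⟩
    refine Set.mem_iInter₂.2 fun n hn => ?_
    have hnot : ∀ i, N + 1 ≤ i → ω ∉ E i := fun i hi => by
      have := hN (i - 1) (by omega)
      rwa [Nat.sub_add_cancel (by omega)] at this
    have hnd : n ≤ n * d := Nat.le_mul_of_pos_right n (by omega)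
    have h1 : (n + 1) * d = n * d + d := by ring
    have a := hnot (n * d + r) (by omega)
    have b := hnot (n * d + (d - r)) (by omega)
    have c := hnot ((n + 1) * d) (by omega)
    exact ⟨⟨fun h => a h.1, fun h => b h.1⟩, fun h => c h.1⟩
  have h := tendsto_measure_iUnion_atTop (μ := μ) (gapEvent_mono (E := E) (d := d) (r := r))
  rw [hone] at h
  exact (ENNReal.tendsto_toReal ENNReal.one_ne_top).comp h

/-- The weights `α / (1 + α)` turn the splitting of the gap event into a two-step recurrence
with polynomial coefficients. -/
lemma gap_recurrence_identity {a b c a' b' c' u v w : ℝ} (ha : 1 + a ≠ 0) (hb : 1 + b ≠ 0)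
    (hc : 1 + c ≠ 0) (ha' : 1 + a' ≠ 0) (hb' : 1 + b' ≠ 0) (hc' : 1 + c' ≠ 0) :
    (a / (1 + a) * (1 - b / (1 + b)) * (1 - c / (1 + c)) * u
      + (1 - a / (1 + a)) * (b / (1 + b)) * (1 - c / (1 + c))
        * (u - a' / (1 + a') * (1 - b' / (1 + b')) * (1 - c' / (1 + c')) * v)
      + (1 - a / (1 + a)) * (1 - b / (1 + b)) * (c / (1 + c))
        * ((1 - a' / (1 + a')) * (1 - b' / (1 + b')) * (1 - c' / (1 + c')) * v)
      + (1 - a / (1 + a)) * (1 - b / (1 + b)) * (1 - c / (1 + c)) * u)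
      * ((1 + a) * (1 + b) * (1 + c) * ((1 + a') * (1 + b') * (1 + c') * w))
    = (1 + a + b) * (u * ((1 + a') * (1 + b') * (1 + c') * w)) + (c - b * a') * (v * w) := by
  have h : ∀ {x : ℝ}, 1 + x ≠ 0 → 1 - x / (1 + x) = 1 / (1 + x) := fun hx => by
    field_simp
    ring
  rw [h ha, h hb, h hc, h ha', h hb', h hc']
  field_simp
  ring

end Events

/-- Let `(E_j)_{j≥1}` be independent events with `P(E_j) = q^j/(1+q^j)` for `0 < q < 1`,
and let `U_{d,r}` be the event that for all `n ≥ 0`: occurrence of `E_{nd+r}` forbids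
`E_{nd+d-r}` and `E_{(n+1)d}`; occurrence of `E_{nd+d-r}` forbids `E_{(n+1)d}` and
`E_{(n+1)d+r}`; and occurrence of `E_{(n+1)d}` forbids `E_{(n+1)d+r}`, `E_{(n+1)d+d-r}`
and `E_{(n+2)d}`. Then `P(E_rᶜ ∩ E_{d-r}ᶜ ∩ E_dᶜ | U_{d,r}) = g₃(-q^r; q^d)`. -/
theorem cond_prob_eq_g3 {Ω : Type*} [MeasurableSpace Ω] (μ : Measure Ω)
    [IsProbabilityMeasure μ]
    (q : ℝ) (hq0 : 0 < q) (hq1 : q < 1)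
    (E : ℕ → Set Ω) (hmeas : ∀ j, MeasurableSet (E j))
    (hindep : ProbabilityTheory.iIndepSet E μ)
    (hprob : ∀ j, 1 ≤ j → μ (E j) = ENNReal.ofReal (q ^ j / (1 + q ^ j)))
    (d r : ℕ) (hd : 3 ≤ d) (hr1 : 1 ≤ r) (hr2 : 2 * r < d)
    (U : Set Ω)
    (hU : U = ⋂ n : ℕ, {ω : Ω |
      (ω ∈ E (n * d + r) → ω ∉ E (n * d + (d - r)) ∧ ω ∉ E ((n + 1) * d)) ∧
      (ω ∈ E (n * d + (d - r)) → ω ∉ E ((n + 1) * d) ∧ ω ∉ E ((n + 1) * d + r)) ∧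
      (ω ∈ E ((n + 1) * d) → ω ∉ E ((n + 1) * d + r) ∧ ω ∉ E ((n + 1) * d + (d - r)) ∧
        ω ∉ E ((n + 2) * d))}) :
    ProbabilityTheory.cond μ U ((E r)ᶜ ∩ (E (d - r))ᶜ ∩ (E d)ᶜ) =
      ENNReal.ofReal (g3R (-q ^ r) (q ^ d)) := by
  have hrd : r < d := by omega
  set Q : ℝ := q ^ d with hQ
  set y₁ : ℝ := q ^ r with hy₁
  set y₂ : ℝ := q ^ (d - r) with hy₂
  have hQ0 : 0 < Q := by positivity
  have hQ1 : Q < 1 := pow_lt_one₀ hq0.le hq1 (by omega)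
  have h₁ : 0 < y₁ := by positivity
  have h₂ : 0 < y₂ := by positivity
  have hy : y₁ * y₂ = Q := by rw [hy₁, hy₂, ← pow_add, Nat.add_sub_cancel' hrd.le]
  have hUgap : U = gapEvent E d r 0 := by
    rw [hU]
    ext ω
    simp only [gapEvent, Set.mem_iInter, Set.mem_inter_iff, Set.mem_compl_iff, Set.mem_union,
      Set.mem_ofPred_eq]
    refine forall_congr' fun n => ?_
    simp only [ge_iff_le, Nat.zero_le, forall_true_left]
    tauto
  have hp : ∀ j, 1 ≤ j → μ.real (E j) = q ^ j / (1 + q ^ j) := fun j hj => by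
    rw [Measure.real, hprob j hj, ENNReal.toReal_ofReal (by positivity)]
  have ha : ∀ k, μ.real (E (k * d + r)) = y₁ * Q ^ k / (1 + y₁ * Q ^ k) := fun k => by
    rw [hp _ (by omega), hQ, hy₁, ← pow_mul, ← pow_add, mul_comm d k, add_comm r]
  have hb : ∀ k, μ.real (E (k * d + (d - r))) = y₂ * Q ^ k / (1 + y₂ * Q ^ k) := fun k => by
    rw [hp _ (by omega), hQ, hy₂, ← pow_mul, ← pow_add, mul_comm d k, add_comm (d - r)]
  have hc : ∀ k, μ.real (E ((k + 1) * d)) = Q * Q ^ k / (1 + Q * Q ^ k) := fun k => by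
    rw [hp _ (Nat.mul_pos k.succ_pos (by omega)), ← pow_succ', hQ, ← pow_mul, mul_comm d]
  have hsum : ∑' j, μ (E (j + 1)) ≠ ⊤ := by
    have hs : Summable fun j : ℕ => q ^ j := summable_geometric_of_lt_one hq0.le hq1
    refine ne_top_of_le_ne_top hs.tsum_ofReal_ne_top (ENNReal.tsum_le_tsum fun j => ?_)
    rw [hprob _ j.succ_pos]
    refine ENNReal.ofReal_le_ofReal ((div_le_self (by positivity)
      (le_add_of_nonneg_right (by positivity))).trans ?_)
    exact pow_le_pow_of_le_one hq0.le hq1.le j.le_succ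
  set W : ℕ → ℝ := fun k => qInf (y₁ * Q ^ k) Q * qInf (y₂ * Q ^ k) Q * qInf (Q * Q ^ k) Q
    with hW
  have hWpos : ∀ k, 0 < W k := fun k => by
    have hI : ∀ y : ℝ, 0 < y → 0 < qInf (y * Q ^ k) Q := fun y hy0 =>
      zero_lt_one.trans_le (one_le_qInf hQ0.le hQ1 (by positivity))
    exact mul_pos (mul_pos (hI _ h₁) (hI _ h₂)) (hI _ hQ0)
  have hWsucc : ∀ k, W k = (1 + y₁ * Q ^ k) * (1 + y₂ * Q ^ k) * (1 + Q * Q ^ k) * W (k + 1) := by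
    intro k
    have hI : ∀ y : ℝ, qInf (y * Q ^ k) Q = (1 + y * Q ^ k) * qInf (y * Q ^ (k + 1)) Q := by
      intro y
      rw [qInf_eq_mul hQ0.le hQ1, mul_assoc y, ← pow_succ]
    simp only [hW]
    rw [hI y₁, hI y₂, hI Q]
    ring
  have hWlim : Tendsto W atTop (𝓝 1) := by
    simpa using ((tendsto_qInf_mul_pow hQ0.le hQ1 h₁.le).mul
      (tendsto_qInf_mul_pow hQ0.le hQ1 h₂.le)).mul (tendsto_qInf_mul_pow hQ0.le hQ1 hQ0.le)
  have hrec : ∀ k, μ.real (gapEvent E d r k) * W k =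
      (1 + (y₁ + y₂) * Q ^ k) * (μ.real (gapEvent E d r (k + 1)) * W (k + 1))
      + Q ^ (k + 1) * (1 - Q ^ (k + 1)) * (μ.real (gapEvent E d r (k + 2)) * W (k + 2)) := by
    intro k
    rw [measureReal_gapEvent hmeas hindep hr1 hr2 k (fun _ => rfl), ha, hb, hc, ha, hb, hc,
      hWsucc k, hWsucc (k + 1)]
    have h₁k : ∀ k, 1 + y₁ * Q ^ k ≠ 0 := fun k => by positivity
    have h₂k : ∀ k, 1 + y₂ * Q ^ k ≠ 0 := fun k => by positivity
    have hQk : ∀ k, 1 + Q * Q ^ k ≠ 0 := fun k => by positivity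
    rw [gap_recurrence_identity (h₁k k) (h₂k k) (hQk k) (h₁k (k + 1)) (h₂k (k + 1))
      (hQk (k + 1))]
    have hprod : y₂ * Q ^ k * (y₁ * Q ^ (k + 1)) = Q ^ (k + 1) * Q ^ (k + 1) := by
      linear_combination Q ^ k * Q ^ (k + 1) * hy
    rw [hprod]
    ring
  obtain ⟨hpos, hsol⟩ := recurrence_solution hQ0 hQ1 h₁ h₂ hy
    (by simpa using (tendsto_measureReal_gapEvent hr1 hrd hsum).mul hWlim) hrec
  have hU0 : 0 < μ.real (gapEvent E d r 0) := (pos_iff_pos_of_mul_pos hpos).2 (hWpos 0)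
  have hgap : ∀ {i k}, i ≤ k * d → MeasurableSet[tailEvents E i] (gapEvent E d r k) :=
    measurableSet_gapEvent hr1 hrd
  have hset : gapEvent E d r 0 ∩ ((E r)ᶜ ∩ (E (d - r))ᶜ ∩ (E d)ᶜ) =
      (E r)ᶜ ∩ ((E (d - r))ᶜ ∩ ((E d)ᶜ ∩ gapEvent E d r 1)) := by
    rw [gapEvent_eq_inter 0]
    ext ω
    simp only [Set.mem_inter_iff, Set.mem_compl_iff, Set.mem_union, zero_mul, zero_add, one_mul]
    tauto
  have hnum : μ.real (gapEvent E d r 0 ∩ ((E r)ᶜ ∩ (E (d - r))ᶜ ∩ (E d)ᶜ)) * W 0 =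
      μ.real (gapEvent E d r 1) * W 1 := by
    have a0 := ha 0
    have b0 := hb 0
    have c0 := hc 0
    simp only [zero_mul, zero_add, one_mul, pow_zero, mul_one] at a0 b0 c0
    rw [hset, measureReal_compl_block_inter hmeas hindep (by omega) (by omega)
      (hgap (by omega)), hWsucc 0, a0, b0, c0]
    simp only [zero_add, pow_zero, mul_one]
    field_simp
    ring
  have hUmeas : MeasurableSet (gapEvent E d r 0) :=
    tailEvents_le hmeas 0 _ (hgap (Nat.zero_le _))
  have hcond : (μ[|gapEvent E d r 0]).real ((E r)ᶜ ∩ (E (d - r))ᶜ ∩ (E d)ᶜ) = g3R (-y₁) Q := by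
    rw [Measure.real, cond_apply hUmeas, ENNReal.toReal_mul, ENNReal.toReal_inv, ← Measure.real,
      ← Measure.real, inv_mul_eq_iff_eq_mul₀ hU0.ne']
    refine mul_right_cancel₀ (hWpos 0).ne' ?_
    rw [hnum, hsol]
    ring
  rw [hUgap, ← hcond, Measure.real, ENNReal.ofReal_toReal]
  exact ((measure_mono (Set.subset_univ _)).trans_lt (by
    have := cond_isProbabilityMeasure (μ := μ) (s := gapEvent E d r 0)
      (fun h => hU0.ne' (by simp [Measure.real, h]))
    simp)).ne
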